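/- Assume G is a good normal subgroup of W~. Let V~ = V~_1 ⊕ V~_2 be a decomposition into W~-stable subspaces with V~_1 and V~_2 irreducible as W~-modules, let W~_1 be the pointwise stabilizer of V~_2 in W~ and W~_2 the pointwise stabilizer of V~_1. If G ∩ W~_1 = 1, G ∩ W~_2 = 1 and G ≠ 1, then V~ has dimension 2, there exists an integer d such that W~_1 and W~_2 are cyclic reflection groups of order d, and G = W~ ∩ SL(V~). -/

import Mathlib

open MvPolynomial

noncomputable section

namespace ReflQuot

variable {k : Type} [Field k]

/-- The action of an invertible matrix `g` on polynomial functions on `k^n`: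
the linear form `X i` is sent to `∑ j, (g⁻¹) i j • X j`, so that
`(g • f) (v) = f (g⁻¹ ⬝ v)`. -/
def matAct {n : ℕ} (g : Matrix.GeneralLinearGroup (Fin n) k) :
    MvPolynomial (Fin n) k →ₐ[k] MvPolynomial (Fin n) k :=
  aeval fun i => ∑ j, ((↑(g⁻¹) : Matrix (Fin n) (Fin n) k) i j) • X j

/-- The algebra endomorphism of `k[X_1,…,X_m]` sending `X i` to `∑ j, M i j • X j`. -/
def polyAct {m : ℕ} (M : Fin m → Fin m → k) :
    MvPolynomial (Fin m) k →ₐ[k] MvPolynomial (Fin m) k :=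
  aeval fun i => ∑ j, M i j • X j

/-- A reflection: an automorphism of finite order whose fixed-point subspace is a
hyperplane. -/
def IsReflection {n : ℕ} (M : Matrix (Fin n) (Fin n) k) : Prop :=
  IsOfFinOrder M ∧
    Module.finrank k (LinearMap.ker (Matrix.toLin' M - LinearMap.id)) + 1 = n

/-- A double reflection: finite order, fixed points of codimension 2. -/
def IsDoubleReflection {n : ℕ} (M : Matrix (Fin n) (Fin n) k) : Prop :=
  IsOfFinOrder M ∧
    Module.finrank k (LinearMap.ker (Matrix.toLin' M - LinearMap.id)) + 2 = n

/-- A reflection group: a group generated by its reflections. -/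
def IsReflectionGroup {n : ℕ} (W : Subgroup (Matrix.GeneralLinearGroup (Fin n) k)) : Prop :=
  Subgroup.closure {g | g ∈ W ∧ IsReflection ((g : Matrix (Fin n) (Fin n) k))} = W

/-- The algebra of `G`-invariant polynomials. -/
def invariants {n : ℕ} (G : Subgroup (Matrix.GeneralLinearGroup (Fin n) k)) :
    Subalgebra k (MvPolynomial (Fin n) k) where
  carrier := {f | ∀ g ∈ G, matAct g f = f}
  mul_mem' := fun {a b} ha hb g hg => by
    rw [map_mul, ha g hg, hb g hg]
  one_mem' := fun g _ => map_one (matAct g)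
  add_mem' := fun {a b} ha hb g hg => by
    rw [map_add, ha g hg, hb g hg]
  zero_mem' := fun g _ => map_zero (matAct g)
  algebraMap_mem' := fun r g _ => (matAct g).commutes r

/-- The linear span of products of two positive-degree invariants, i.e. `(B^G_+)^2`. -/
def sqSpan {n : ℕ} (G : Subgroup (Matrix.GeneralLinearGroup (Fin n) k)) :
    Submodule k (MvPolynomial (Fin n) k) :=
  Submodule.span k {f | ∃ u ∈ invariants G, ∃ v ∈ invariants G,
    constantCoeff u = 0 ∧ constantCoeff v = 0 ∧ f = u * v}

/-- The ideal of positive-degree elements of the polynomial ring. -/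
def idealPlus (k : Type) [Field k] (m : ℕ) : Ideal (MvPolynomial (Fin m) k) :=
  Ideal.span (Set.range X)

/-- The ideal `I` of relations between the generators `p i` of the invariant algebra:
the kernel of `k[V] = k[X_1,…,X_m] → B^G`, `X i ↦ p i`. -/
def relIdeal {n m : ℕ} (p : Fin m → MvPolynomial (Fin n) k) :
    Ideal (MvPolynomial (Fin m) k) :=
  RingHom.ker (aeval p : MvPolynomial (Fin m) k →ₐ[k] MvPolynomial (Fin n) k)

/-- The context: `Wt` is a finite reflection group on `k^n`, `G` a normal subgroup of `Wt`,
`p` a minimal system of homogeneous generators (of degrees `d`) of the invariant algebra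
`B^G` whose span is `Wt`-stable (i.e. a graded `W`-equivariant section of
`B^G_+ → B^G_+/(B^G_+)^2`), and `c w` the matrix of the action of `w` on the span of the
`p i`, giving the induced action of `W = Wt/G` on `V = k^m`. -/
structure QuotSetup {n m : ℕ} (Wt G : Subgroup (Matrix.GeneralLinearGroup (Fin n) k))
    (p : Fin m → MvPolynomial (Fin n) k) (d : Fin m → ℕ)
    (c : ↥Wt → Fin m → Fin m → k) : Prop where
  finite : (Wt : Set (Matrix.GeneralLinearGroup (Fin n) k)).Finite
  reflGroup : IsReflectionGroup Wt
  le : G ≤ Wt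
  normal : ∀ w ∈ Wt, ∀ g ∈ G, w * g * w⁻¹ ∈ G
  homog : ∀ i, (p i).IsHomogeneous (d i)
  dpos : ∀ i, 0 < d i
  gen : Algebra.adjoin k (Set.range p) = invariants G
  minimal : ∀ a : Fin m → k, (∑ i, a i • p i) ∈ sqSpan G → a = 0
  equivar : ∀ (w : ↥Wt) (i), matAct (w : Matrix.GeneralLinearGroup (Fin n) k) (p i)
      = ∑ j, c w i j • p j

/-- `W = Wt/G` acts trivially on the conormal module `I/(A_+ I)`. -/
def TrivialConormal {n m : ℕ} (Wt : Subgroup (Matrix.GeneralLinearGroup (Fin n) k))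
    (p : Fin m → MvPolynomial (Fin n) k) (c : ↥Wt → Fin m → Fin m → k) : Prop :=
  ∀ w : ↥Wt, ∀ f ∈ relIdeal p, polyAct (c w) f - f ∈ idealPlus k m * relIdeal p

/-- `G` is of complete intersection: `I` is generated by `dim V - dim Vt = m - n` elements. -/
def IsCompleteIntersection {n m : ℕ} (p : Fin m → MvPolynomial (Fin n) k) : Prop :=
  ∃ s : Finset (MvPolynomial (Fin m) k), s.card = m - n ∧ Ideal.span (s : Set _) = relIdeal p

/-- `G` is a good normal subgroup of `Wt`. -/
def IsGoodQuot {n m : ℕ} (Wt : Subgroup (Matrix.GeneralLinearGroup (Fin n) k))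
    (p : Fin m → MvPolynomial (Fin n) k) (c : ↥Wt → Fin m → Fin m → k) : Prop :=
  IsCompleteIntersection p ∧ TrivialConormal Wt p c


/-- The pointwise stabilizer of a subspace `L` in `GL_n(k)`. -/
def pointStab {n : ℕ} (L : Submodule k (Fin n → k)) :
    Subgroup (Matrix.GeneralLinearGroup (Fin n) k) where
  carrier := {g | ∀ x ∈ L, Matrix.mulVec (g : Matrix (Fin n) (Fin n) k) x = x}
  one_mem' := fun x _ => Matrix.one_mulVec x
  mul_mem' := fun {a b} ha hb x hx => by
    rw [Units.val_mul, ← Matrix.mulVec_mulVec, hb x hx, ha x hx]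
  inv_mem' := fun {a} ha x hx => by
    have h1 : Matrix.mulVec (↑(a⁻¹) : Matrix (Fin n) (Fin n) k)
        (Matrix.mulVec (↑a : Matrix (Fin n) (Fin n) k) x) = x := by
      rw [Matrix.mulVec_mulVec, ← Units.val_mul, inv_mul_cancel, Units.val_one,
        Matrix.one_mulVec]
    rw [ha x hx] at h1
    exact h1

/-- The set of reflecting hyperplanes of a subgroup `W` of `GL_n(k)`. -/
def reflHyps {n : ℕ} (W : Subgroup (Matrix.GeneralLinearGroup (Fin n) k)) :
    Set (Submodule k (Fin n → k)) :=
  {H | ∃ g ∈ W, IsReflection ((g : Matrix (Fin n) (Fin n) k)) ∧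
      H = LinearMap.ker (Matrix.toLin' ((g : Matrix (Fin n) (Fin n) k)) - LinearMap.id)}

/-- The set `A'(Wt)` of reflecting hyperplanes `H` of `Wt` such that `Wt_H ≠ G_H`. -/
def reflHyps' {n : ℕ} (Wt G : Subgroup (Matrix.GeneralLinearGroup (Fin n) k)) :
    Set (Submodule k (Fin n → k)) :=
  {H | H ∈ reflHyps Wt ∧ ¬ (Wt ⊓ pointStab H ≤ G)}

/-- `Wt_H` and `Wt_{H'}` have the same image in `W = Wt/G`. -/
def imageEq {n : ℕ} (Wt G : Subgroup (Matrix.GeneralLinearGroup (Fin n) k))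
    (H H' : Submodule k (Fin n → k)) : Prop :=
  {x | ∃ g ∈ G, ∃ u ∈ Wt ⊓ pointStab H, x = g * u}
    = {x | ∃ g ∈ G, ∃ u ∈ Wt ⊓ pointStab H', x = g * u}

/-- `e_H = |G_H|`. -/
def eH {n : ℕ} (G : Subgroup (Matrix.GeneralLinearGroup (Fin n) k))
    (H : Submodule k (Fin n → k)) : ℕ :=
  Nat.card ↥(G ⊓ pointStab H)

/-- The map `p : Vt → V`, `x ↦ (p 1 (x), …, p m (x))`. -/
def pMap {n m : ℕ} (p : Fin m → MvPolynomial (Fin n) k) (x : Fin n → k) : Fin m → k :=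
  fun i => eval x (p i)

/-- The matrix of the action of (the image in `W` of) `w` on `V = k^m`. -/
def qMat {n m : ℕ} {Wt : Subgroup (Matrix.GeneralLinearGroup (Fin n) k)}
    (c : ↥Wt → Fin m → Fin m → k) (w : ↥Wt) : Matrix (Fin m) (Fin m) k :=
  Matrix.of (c w⁻¹)

/-- The set of reflecting hyperplanes of `W = Wt/G` acting on `V = k^m`. -/
def reflHypsV {n m : ℕ} {Wt : Subgroup (Matrix.GeneralLinearGroup (Fin n) k)}
    (c : ↥Wt → Fin m → Fin m → k) : Set (Submodule k (Fin m → k)) :=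
  {K | ∃ w : ↥Wt, IsReflection (qMat c w) ∧
      K = LinearMap.ker (Matrix.toLin' (qMat c w) - LinearMap.id)}

/-- The underlying matrix of an element of a subgroup of `GL_n(k)`. -/
def matOf {n : ℕ} {Wt : Subgroup (Matrix.GeneralLinearGroup (Fin n) k)} (w : ↥Wt) :
    Matrix (Fin n) (Fin n) k :=
  ((w : Matrix.GeneralLinearGroup (Fin n) k) : Matrix (Fin n) (Fin n) k)

/-- Restriction of a polynomial function to the plane spanned by `v1` and `v2`,
in the coordinates given by these two vectors. -/
def planeRestrict {n : ℕ} (v1 v2 : Fin n → k) :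
    MvPolynomial (Fin n) k →ₐ[k] MvPolynomial (Fin 2) k :=
  aeval fun i => v1 i • X 0 + v2 i • X 1

/-- The linear polynomial attached to a linear form. -/
def linPoly {n : ℕ} (φ : (Fin n → k) →ₗ[k] k) : MvPolynomial (Fin n) k :=
  ∑ i, φ (Pi.single i 1) • X i

lemma sum_mul_apply_single {n : ℕ} (φ : (Fin n → k) →ₗ[k] k) (v : Fin n → k) :
    ∑ i, φ (Pi.single i 1) * v i = φ v := by
  conv_rhs => rw [pi_eq_sum_univ' v]
  simp [mul_comm]

lemma planeRestrict_linPoly {n : ℕ} (v1 v2 : Fin n → k) (φ : (Fin n → k) →ₗ[k] k) :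
    planeRestrict v1 v2 (linPoly φ) = φ v1 • X 0 + φ v2 • X 1 := by
  simp only [planeRestrict, linPoly, map_sum, map_smul, aeval_X, smul_add, smul_smul,
    Finset.sum_add_distrib, ← Finset.sum_smul, sum_mul_apply_single]

lemma planeRestrict_matAct {n : ℕ} (v1 v2 : Fin n → k)
    (g : Matrix.GeneralLinearGroup (Fin n) k) (f : MvPolynomial (Fin n) k) :
    planeRestrict v1 v2 (matAct g f) =
      planeRestrict (Matrix.mulVec ((g⁻¹ : Matrix.GeneralLinearGroup (Fin n) k) :
          Matrix (Fin n) (Fin n) k) v1)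
        (Matrix.mulVec ((g⁻¹ : Matrix.GeneralLinearGroup (Fin n) k) :
          Matrix (Fin n) (Fin n) k) v2) f := by
  rw [← AlgHom.comp_apply]
  congr 1
  ext1 i
  simp only [planeRestrict, matAct, AlgHom.comp_apply, aeval_X, map_sum, map_smul, smul_add,
    smul_smul, Finset.sum_add_distrib, ← Finset.sum_smul]
  rfl

lemma matAct_linPoly {n : ℕ} (g : Matrix.GeneralLinearGroup (Fin n) k)
    (φ : (Fin n → k) →ₗ[k] k) :
    matAct g (linPoly φ) =
      linPoly (φ ∘ₗ Matrix.mulVecLin ((g⁻¹ : Matrix.GeneralLinearGroup (Fin n) k) :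
        Matrix (Fin n) (Fin n) k)) := by
  simp only [linPoly, matAct, map_sum, map_smul, aeval_X, Finset.smul_sum, smul_smul]
  rw [Finset.sum_comm]
  refine Finset.sum_congr rfl fun j _ => ?_
  rw [← Finset.sum_smul, sum_mul_apply_single φ fun i =>
    ((g⁻¹ : Matrix.GeneralLinearGroup (Fin n) k) : Matrix (Fin n) (Fin n) k) i j]
  simp only [LinearMap.comp_apply, Matrix.mulVecLin_apply, Matrix.mulVec_single_one]
  rfl

lemma coeff_planeRestrict_smul {n : ℕ} (v1 v2 : Fin n → k) (a b : k)
    (f : MvPolynomial (Fin n) k) (D : Fin 2 →₀ ℕ) :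
    coeff D (planeRestrict (a • v1) (b • v2) f) =
      a ^ D 0 * b ^ D 1 * coeff D (planeRestrict v1 v2 f) := by
  have h : planeRestrict (a • v1) (b • v2) =
      (aeval ![a • X 0, b • X 1] : MvPolynomial (Fin 2) k →ₐ[k] MvPolynomial (Fin 2) k).comp
        (planeRestrict v1 v2) := by
    ext1 i
    simp [planeRestrict, smul_smul, mul_comm]
  rw [h, AlgHom.comp_apply]
  induction planeRestrict v1 v2 f using MvPolynomial.induction_on' with
  | add p q hp hq => rw [map_add, coeff_add, coeff_add, hp, hq, mul_add]
  | monomial D' r =>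
    have : aeval ![a • X 0, b • X 1] (monomial D' r) =
        monomial D' (a ^ D' 0 * b ^ D' 1 * r) := by
      rw [aeval_monomial, Finsupp.prod_fintype _ _ (by simp), monomial_eq,
        Finsupp.prod_fintype _ _ (by simp)]
      simp [Fin.prod_univ_two, smul_eq_C_mul, mul_pow, algebraMap_eq]
      ring
    rw [this, coeff_monomial, coeff_monomial]
    split_ifs with hD
    · rw [hD]
    · simp

/-- The exponent vector `(i, j)` of bivariate polynomials. -/
def biExp (i j : ℕ) : Fin 2 →₀ ℕ := Finsupp.single 0 i + Finsupp.single 1 j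

lemma biExp_zero (i j : ℕ) : biExp i j 0 = i := by simp [biExp]

lemma biExp_one (i j : ℕ) : biExp i j 1 = j := by simp [biExp]

lemma coeff_planeRestrict_linPoly_pow {n : ℕ} {v1 v2 : Fin n → k}
    {φ ψ : (Fin n → k) →ₗ[k] k} (hφ : φ v2 = 0) (hψ : ψ v1 = 0) (i j i' j' : ℕ) :
    coeff (biExp i' j') (planeRestrict v1 v2 (linPoly φ ^ i * linPoly ψ ^ j)) =
      if i = i' ∧ j = j' then φ v1 ^ i * ψ v2 ^ j else 0 := by
  have h : planeRestrict v1 v2 (linPoly φ ^ i * linPoly ψ ^ j) =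
      monomial (biExp i j) (φ v1 ^ i * ψ v2 ^ j) := by
    rw [map_mul, map_pow, map_pow, planeRestrict_linPoly, planeRestrict_linPoly, hφ, hψ,
      monomial_eq, Finsupp.prod_fintype _ _ (by simp)]
    simp [Fin.prod_univ_two, biExp_zero, biExp_one, smul_eq_C_mul, mul_pow]
    ring
  rw [h, coeff_monomial]
  congr 1
  refine propext ⟨fun h => ?_, fun h => by rw [h.1, h.2]⟩
  have h0 := DFunLike.congr_fun h 0
  have h1 := DFunLike.congr_fun h 1
  rw [biExp_zero, biExp_zero] at h0
  rw [biExp_one, biExp_one] at h1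
  exact ⟨h0, h1⟩

lemma coeff_zero_planeRestrict {n : ℕ} (v1 v2 : Fin n → k) (f : MvPolynomial (Fin n) k) :
    coeff 0 (planeRestrict v1 v2 f) = constantCoeff f := by
  rw [← constantCoeff_eq]
  induction f using MvPolynomial.induction_on with
  | C a => simp [planeRestrict]
  | add p q hp hq => simp [hp, hq]
  | mul_X p i hp => simp [planeRestrict]

lemma constantCoeff_matAct {n : ℕ} (g : Matrix.GeneralLinearGroup (Fin n) k)
    (f : MvPolynomial (Fin n) k) : constantCoeff (matAct g f) = constantCoeff f := by
  rw [← coeff_zero_planeRestrict 0 0, planeRestrict_matAct, Matrix.mulVec_zero,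
    coeff_zero_planeRestrict]

/-- A linear form on polynomials which kills the constants and the products of two
invariants without constant term. -/
structure IsCotangentForm {n : ℕ} (G : Subgroup (Matrix.GeneralLinearGroup (Fin n) k))
    (L : MvPolynomial (Fin n) k →ₗ[k] k) : Prop where
  map_one : L 1 = 0
  map_mul : ∀ u ∈ invariants G, ∀ v ∈ invariants G, constantCoeff u = 0 →
    constantCoeff v = 0 → L (u * v) = 0

/-- The derivation of `k[X_1,…,X_m]` with constant coefficients `L (p i)`. -/
def constDeriv {n m : ℕ} (p : Fin m → MvPolynomial (Fin n) k)
    (L : MvPolynomial (Fin n) k →ₗ[k] k) :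
    Derivation k (MvPolynomial (Fin m) k) (MvPolynomial (Fin m) k) :=
  mkDerivation k fun i => C (L (p i))

section pairing

variable {n m : ℕ} {Wt G : Subgroup (Matrix.GeneralLinearGroup (Fin n) k)}
  {p : Fin m → MvPolynomial (Fin n) k} {d : Fin m → ℕ} {c : ↥Wt → Fin m → Fin m → k}

lemma QuotSetup.constantCoeff_gen (hs : QuotSetup Wt G p d c) (i : Fin m) :
    constantCoeff (p i) = 0 := by
  rw [constantCoeff_eq]
  exact (hs.homog i).coeff_eq_zero (by simpa using (hs.dpos i).ne)

lemma QuotSetup.constantCoeff_aeval (hs : QuotSetup Wt G p d c)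
    (P : MvPolynomial (Fin m) k) : constantCoeff (aeval p P) = constantCoeff P := by
  induction P using MvPolynomial.induction_on with
  | C a => simp
  | add P Q hP hQ => rw [map_add, map_add, hP, hQ, map_add]
  | mul_X P i hp => simp [hs.constantCoeff_gen]

lemma QuotSetup.aeval_mem (hs : QuotSetup Wt G p d c) (P : MvPolynomial (Fin m) k) :
    aeval p P ∈ invariants G := by
  rw [← hs.gen, Algebra.adjoin_range_eq_range_aeval]
  exact ⟨P, rfl⟩

lemma QuotSetup.exists_aeval_eq (hs : QuotSetup Wt G p d c) {f : MvPolynomial (Fin n) k}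
    (hf : f ∈ invariants G) : ∃ P : MvPolynomial (Fin m) k, aeval p P = f := by
  rw [← hs.gen, Algebra.adjoin_range_eq_range_aeval] at hf
  exact hf

lemma QuotSetup.aeval_polyAct (hs : QuotSetup Wt G p d c) (w : ↥Wt)
    (P : MvPolynomial (Fin m) k) :
    aeval p (polyAct (c w) P) =
      matAct (w : Matrix.GeneralLinearGroup (Fin n) k) (aeval p P) := by
  rw [← AlgHom.comp_apply, ← AlgHom.comp_apply]
  congr 1
  ext1 i
  simp [polyAct, hs.equivar]

lemma QuotSetup.constantCoeff_constDeriv (hs : QuotSetup Wt G p d c)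
    {L : MvPolynomial (Fin n) k →ₗ[k] k} (hL : IsCotangentForm G L)
    (P : MvPolynomial (Fin m) k) : constantCoeff (constDeriv p L P) = L (aeval p P) := by
  have hC : ∀ a : k, L (C a) = 0 := fun a => by
    rw [← mul_one (C a), ← smul_eq_C_mul, map_smul, hL.map_one, smul_zero]
  induction P using MvPolynomial.induction_on with
  | C a => simp [hC, algebraMap_eq]
  | add P Q hP hQ => simp only [map_add, hP, hQ]
  | mul_X P i hp =>
    have h1 : aeval p (P * X i) =
        aeval p (P - C (constantCoeff P)) * aeval p (X i : MvPolynomial (Fin m) k) +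
          constantCoeff P • p i := by
      simp only [map_mul, map_sub, aeval_X, aeval_C, algebraMap_eq, smul_eq_C_mul]
      ring
    rw [h1, map_add, hL.map_mul _ (hs.aeval_mem _) _ (hs.aeval_mem _)
      (by rw [hs.constantCoeff_aeval, map_sub, constantCoeff_C, sub_self])
      (by rw [hs.constantCoeff_aeval, constantCoeff_X])]
    simp [constDeriv, mkDerivation_X]

lemma QuotSetup.constantCoeff_constDeriv_mul (hs : QuotSetup Wt G p d c)
    {L M : MvPolynomial (Fin n) k →ₗ[k] k} (hL : IsCotangentForm G L)
    (hM : IsCotangentForm G M) {P Q : MvPolynomial (Fin m) k}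
    (hP : constantCoeff P = 0) (hQ : constantCoeff Q = 0) :
    constantCoeff (constDeriv p L (constDeriv p M (P * Q))) =
      L (aeval p P) * M (aeval p Q) + M (aeval p P) * L (aeval p Q) := by
  simp only [Derivation.leibniz, smul_eq_mul, map_add, map_mul, hs.constantCoeff_constDeriv hL,
    hs.constantCoeff_constDeriv hM, hP, hQ]
  ring

lemma QuotSetup.constantCoeff_constDeriv_eq_zero (hs : QuotSetup Wt G p d c)
    {L M : MvPolynomial (Fin n) k →ₗ[k] k} (hL : IsCotangentForm G L)
    (hM : IsCotangentForm G M) {f : MvPolynomial (Fin m) k}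
    (hf : f ∈ idealPlus k m * relIdeal p) :
    constantCoeff (constDeriv p L (constDeriv p M f)) = 0 := by
  induction hf using Submodule.mul_induction_on' with
  | add x _ y _ hx hy => simp [hx, hy]
  | mem_mul_mem P hP R hR =>
    have hR0 : aeval p R = 0 := hR
    have hP0 : constantCoeff P = 0 := by
      have : idealPlus k m ≤ RingHom.ker (constantCoeff (R := k) (σ := Fin m)) := by
        rw [idealPlus, Ideal.span_le]
        rintro _ ⟨i, rfl⟩
        simp
      exact this hP
    rw [hs.constantCoeff_constDeriv_mul hL hM hP0
      (by rw [← hs.constantCoeff_aeval, hR0, map_zero]), hR0]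
    simp

/-- The quadratic part of a relation `u * v = q * r` between invariants is preserved by `W`,
when `W` acts trivially on the conormal module. -/
lemma TrivialConormal.pairing_eq (ht : TrivialConormal Wt p c) (hs : QuotSetup Wt G p d c)
    {L M : MvPolynomial (Fin n) k →ₗ[k] k} (hL : IsCotangentForm G L)
    (hM : IsCotangentForm G M) {u v q r : MvPolynomial (Fin n) k}
    (hu : u ∈ invariants G) (hv : v ∈ invariants G) (hq : q ∈ invariants G)
    (hr : r ∈ invariants G) (hu0 : constantCoeff u = 0) (hv0 : constantCoeff v = 0)
    (hq0 : constantCoeff q = 0) (hr0 : constantCoeff r = 0) (huv : u * v = q * r) (w : ↥Wt)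
    (hLq : L q = 0) (hLr : L r = 0)
    (hLq' : L (matAct (w : Matrix.GeneralLinearGroup (Fin n) k) q) = 0)
    (hLr' : L (matAct (w : Matrix.GeneralLinearGroup (Fin n) k) r) = 0) :
    L (matAct (w : Matrix.GeneralLinearGroup (Fin n) k) u) *
          M (matAct (w : Matrix.GeneralLinearGroup (Fin n) k) v) +
        M (matAct (w : Matrix.GeneralLinearGroup (Fin n) k) u) *
          L (matAct (w : Matrix.GeneralLinearGroup (Fin n) k) v) =
      L u * M v + M u * L v := by
  obtain ⟨U, rfl⟩ := hs.exists_aeval_eq hu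
  obtain ⟨V, rfl⟩ := hs.exists_aeval_eq hv
  obtain ⟨Q, rfl⟩ := hs.exists_aeval_eq hq
  obtain ⟨R, rfl⟩ := hs.exists_aeval_eq hr
  have hpoly : ∀ P : MvPolynomial (Fin m) k, constantCoeff (aeval p P) = 0 →
      constantCoeff (polyAct (c w) P) = 0 := fun P hP => by
    rw [← hs.constantCoeff_aeval, hs.aeval_polyAct, constantCoeff_matAct, hP]
  have hmem : U * V - Q * R ∈ relIdeal p := by
    change aeval p (U * V - Q * R) = 0
    rw [map_sub, map_mul, map_mul, huv, sub_self]
  have key := hs.constantCoeff_constDeriv_eq_zero hL hM (ht w _ hmem)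
  have hU := hpoly U hu0
  have hV := hpoly V hv0
  have hQ := hpoly Q hq0
  have hR := hpoly R hr0
  rw [hs.constantCoeff_aeval] at hu0 hv0 hq0 hr0
  simp only [map_sub, map_mul (polyAct (c w)), hs.constantCoeff_constDeriv_mul hL hM hU hV,
    hs.constantCoeff_constDeriv_mul hL hM hQ hR, hs.constantCoeff_constDeriv_mul hL hM hu0 hv0,
    hs.constantCoeff_constDeriv_mul hL hM hq0 hr0, hs.aeval_polyAct, hLq, hLr, hLq', hLr']
    at key
  linear_combination key

end pairing

/-- The linear form taking the coefficient of `s ^ i * t ^ j` in `f (s • v1 + t • v2)`. -/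
def coeffForm {n : ℕ} (v1 v2 : Fin n → k) (i j : ℕ) : MvPolynomial (Fin n) k →ₗ[k] k :=
  lcoeff k (biExp i j) ∘ₗ (planeRestrict v1 v2).toLinearMap

lemma coeffForm_apply {n : ℕ} (v1 v2 : Fin n → k) (i j : ℕ) (f : MvPolynomial (Fin n) k) :
    coeffForm v1 v2 i j f = coeff (biExp i j) (planeRestrict v1 v2 f) := rfl

lemma eq_one_of_coeff_planeRestrict_ne_zero {n : ℕ}
    {G : Subgroup (Matrix.GeneralLinearGroup (Fin n) k)}
    {γ : Matrix.GeneralLinearGroup (Fin n) k} (hγ : γ ∈ G) {v1 v2 : Fin n → k} {a b : k}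
    (h1 : Matrix.mulVec (γ : Matrix (Fin n) (Fin n) k) v1 = a • v1)
    (h2 : Matrix.mulVec (γ : Matrix (Fin n) (Fin n) k) v2 = b • v2)
    {f : MvPolynomial (Fin n) k} (hf : f ∈ invariants G) {D : Fin 2 →₀ ℕ}
    (hD : coeff D (planeRestrict v1 v2 f) ≠ 0) : a ^ D 0 * b ^ D 1 = 1 := by
  have h := coeff_planeRestrict_smul v1 v2 a b f D
  rw [← h1, ← h2] at h
  have h' := planeRestrict_matAct v1 v2 γ⁻¹ f
  rw [hf _ (inv_mem hγ), inv_inv] at h'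
  rw [← h'] at h
  exact mul_right_cancel₀ hD (by rw [one_mul, ← h])

lemma isCotangentForm_coeffForm {n : ℕ}
    {G : Subgroup (Matrix.GeneralLinearGroup (Fin n) k)}
    {γ : Matrix.GeneralLinearGroup (Fin n) k} (hγ : γ ∈ G) {v1 v2 : Fin n → k} {a b : k}
    (h1 : Matrix.mulVec (γ : Matrix (Fin n) (Fin n) k) v1 = a • v1)
    (h2 : Matrix.mulVec (γ : Matrix (Fin n) (Fin n) k) v2 = b • v2) {i j : ℕ}
    (hij : i ≠ 0 ∨ j ≠ 0)
    (h : ∀ i1 j1 i2 j2, i1 + i2 = i → j1 + j2 = j → a ^ i1 * b ^ j1 = 1 →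
      a ^ i2 * b ^ j2 = 1 → (i1 = 0 ∧ j1 = 0) ∨ (i2 = 0 ∧ j2 = 0)) :
    IsCotangentForm G (coeffForm v1 v2 i j) where
  map_one := by
    rw [coeffForm_apply, map_one, coeff_one, if_neg]
    intro h0
    have e0 := DFunLike.congr_fun h0 0
    have e1 := DFunLike.congr_fun h0 1
    rw [biExp_zero] at e0
    rw [biExp_one] at e1
    rcases hij with hi | hj
    · exact hi e0.symm
    · exact hj e1.symm
  map_mul := by
    intro u hu v hv hu0 hv0
    rw [coeffForm_apply, map_mul, coeff_mul]
    refine Finset.sum_eq_zero fun D hD => ?_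
    rw [Finset.HasAntidiagonal.mem_antidiagonal] at hD
    by_contra hne
    have hne1 := left_ne_zero_of_mul hne
    have hne2 := right_ne_zero_of_mul hne
    have e0 := DFunLike.congr_fun hD 0
    have e1 := DFunLike.congr_fun hD 1
    rw [Finsupp.add_apply, biExp_zero] at e0
    rw [Finsupp.add_apply, biExp_one] at e1
    have hzero : ∀ D : Fin 2 →₀ ℕ, D 0 = 0 ∧ D 1 = 0 → D = 0 := fun D h => by
      ext l
      fin_cases l
      · exact h.1
      · exact h.2
    rcases h _ _ _ _ e0 e1 (eq_one_of_coeff_planeRestrict_ne_zero hγ h1 h2 hu hne1)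
      (eq_one_of_coeff_planeRestrict_ne_zero hγ h1 h2 hv hne2) with h' | h'
    · rw [hzero _ h', coeff_zero_planeRestrict] at hne1
      exact hne1 hu0
    · rw [hzero _ h', coeff_zero_planeRestrict] at hne2
      exact hne2 hv0

/-- A matrix group element acts as the scalar `a` on the subspace `V`. -/
def ActsAs {n : ℕ} (g : Matrix.GeneralLinearGroup (Fin n) k) (V : Submodule k (Fin n → k))
    (a : k) : Prop :=
  ∀ x ∈ V, Matrix.mulVec (g : Matrix (Fin n) (Fin n) k) x = a • x

lemma linearMap_ext_isCompl {n : ℕ} {V1 V2 : Submodule k (Fin n → k)} (hc : IsCompl V1 V2)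
    {N : Type*} [AddCommGroup N] [Module k N]
    {f g : (Fin n → k) →ₗ[k] N} (h1 : ∀ x ∈ V1, f x = g x) (h2 : ∀ x ∈ V2, f x = g x) :
    f = g := by
  refine LinearMap.ext fun x => ?_
  have hx : x ∈ V1 ⊔ V2 := hc.sup_eq_top ▸ Submodule.mem_top
  obtain ⟨y, hy, z, hz, rfl⟩ := Submodule.mem_sup.1 hx
  rw [map_add, map_add, h1 y hy, h2 z hz]

lemma linPoly_pow_mem_invariants {n : ℕ}
    {G : Subgroup (Matrix.GeneralLinearGroup (Fin n) k)} {V1 V2 : Submodule k (Fin n → k)}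
    (hc : IsCompl V1 V2) {φ ψ : (Fin n → k) →ₗ[k] k} (hφ : ∀ x ∈ V2, φ x = 0)
    (hψ : ∀ x ∈ V1, ψ x = 0) {i j : ℕ}
    (h : ∀ g ∈ G, ∃ a b : k, ActsAs g V1 a ∧ ActsAs g V2 b ∧ a ^ i * b ^ j = 1) :
    linPoly φ ^ i * linPoly ψ ^ j ∈ invariants G := by
  intro g hg
  obtain ⟨a, b, ha, hb, hab⟩ := h g⁻¹ (inv_mem hg)
  have e1 : φ ∘ₗ Matrix.mulVecLin ((g⁻¹ : Matrix.GeneralLinearGroup (Fin n) k) :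
      Matrix (Fin n) (Fin n) k) = a • φ := by
    apply linearMap_ext_isCompl hc
    · intro x hx
      simp only [LinearMap.comp_apply, Matrix.mulVecLin_apply, ha x hx, map_smul,
        LinearMap.smul_apply]
    · intro x hx
      simp only [LinearMap.comp_apply, Matrix.mulVecLin_apply, hb x hx, hφ x hx, map_smul, smul_zero,
        LinearMap.smul_apply]
  have e2 : ψ ∘ₗ Matrix.mulVecLin ((g⁻¹ : Matrix.GeneralLinearGroup (Fin n) k) :
      Matrix (Fin n) (Fin n) k) = b • ψ := by
    apply linearMap_ext_isCompl hc
    · intro x hx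
      simp only [LinearMap.comp_apply, Matrix.mulVecLin_apply, ha x hx, hψ x hx, map_smul, smul_zero,
        LinearMap.smul_apply]
    · intro x hx
      simp only [LinearMap.comp_apply, Matrix.mulVecLin_apply, hb x hx, map_smul,
        LinearMap.smul_apply]
  have hsmul : ∀ (r : k) (χ : (Fin n → k) →ₗ[k] k), linPoly (r • χ) = C r * linPoly χ :=
    fun r χ => by simp [linPoly, Finset.mul_sum, smul_eq_C_mul, mul_assoc]
  rw [map_mul, map_pow, map_pow, matAct_linPoly, matAct_linPoly, e1, e2, hsmul, hsmul]
  calc _ = C (a ^ i * b ^ j) * (linPoly φ ^ i * linPoly ψ ^ j) := by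
        simp only [map_mul, map_pow]; ring
    _ = _ := by rw [hab, C_1, one_mul]

lemma constantCoeff_linPoly_pow_mul {n : ℕ} (φ ψ : (Fin n → k) →ₗ[k] k) {i j : ℕ}
    (hij : i ≠ 0 ∨ j ≠ 0) : constantCoeff (linPoly φ ^ i * linPoly ψ ^ j) = 0 := by
  have h : ∀ χ : (Fin n → k) →ₗ[k] k, constantCoeff (linPoly χ) = 0 := fun χ => by
    simp [linPoly, smul_eq_C_mul]
  rw [map_mul, map_pow, map_pow, h, h]
  rcases hij with hi | hj
  · rw [zero_pow hi, zero_mul]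
  · rw [zero_pow hj, mul_zero]

/-- The semi-invariance of `φ ^ c * ψ ^ (c * b)` forced by the relation
`ψ ^ e * (φ ^ c * ψ ^ (c * b - e)) = (φ * ψ ^ b) ^ c`. -/
lemma TrivialConormal.apply_pow_mul_apply_pow_eq {n m : ℕ}
    {Wt G : Subgroup (Matrix.GeneralLinearGroup (Fin n) k)}
    {p : Fin m → MvPolynomial (Fin n) k} {d : Fin m → ℕ} {c : ↥Wt → Fin m → Fin m → k}
    (ht : TrivialConormal Wt p c) (hs : QuotSetup Wt G p d c)
    {V1 V2 : Submodule k (Fin n → k)} (hc : IsCompl V1 V2)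
    (hstab1 : ∀ w ∈ Wt, ∀ x ∈ V1, Matrix.mulVec (w : Matrix (Fin n) (Fin n) k) x ∈ V1)
    (hstab2 : ∀ w ∈ Wt, ∀ x ∈ V2, Matrix.mulVec (w : Matrix (Fin n) (Fin n) k) x ∈ V2)
    {γ : Matrix.GeneralLinearGroup (Fin n) k} (hγ : γ ∈ G) {ζ η : k} (hζ : ActsAs γ V1 ζ)
    (hη : ActsAs γ V2 η) {e b r : ℕ} (hbe : b < e) (hr : 0 < r) (hrb : r * b < e)
    (her : e ≤ (r + 1) * b) (hmod : ∀ i j, ζ ^ i * η ^ j = 1 → j ≡ i * b [MOD e])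
    (hG : ∀ g ∈ G, ∃ a a' : k, ActsAs g V1 a ∧ ActsAs g V2 a' ∧ a * a' ^ b = 1 ∧ a' ^ e = 1)
    {φ ψ : (Fin n → k) →ₗ[k] k} (hφ : ∀ x ∈ V2, φ x = 0) (hψ : ∀ x ∈ V1, ψ x = 0)
    {v1 v2 : Fin n → k} (hv1 : v1 ∈ V1) (hv2 : v2 ∈ V2)
    {w : Matrix.GeneralLinearGroup (Fin n) k} (hw : w ∈ Wt) :
    φ (Matrix.mulVec (w : Matrix (Fin n) (Fin n) k) v1) ^ (r + 1) *
        ψ (Matrix.mulVec (w : Matrix (Fin n) (Fin n) k) v2) ^ ((r + 1) * b) =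
      φ v1 ^ (r + 1) * ψ v2 ^ ((r + 1) * b) := by
  obtain ⟨s, hs'⟩ := Nat.exists_eq_add_of_le her
  have hsb : s < b := by nlinarith
  have hinv : ∀ i j l, i * b + l * e = j ∨ i * b = l * e + j →
      linPoly φ ^ i * linPoly ψ ^ j ∈ invariants G := by
    intro i j l hl
    refine linPoly_pow_mem_invariants hc hφ hψ fun g hg => ?_
    obtain ⟨a, a', ha, ha', hab, hae⟩ := hG g hg
    refine ⟨a, a', ha, ha', ?_⟩
    have h1 : a ^ i * a' ^ (i * b) = 1 := by
      rw [mul_comm i b, pow_mul, ← mul_pow, hab, one_pow]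
    have h2 : a' ^ (l * e) = 1 := by rw [mul_comm, pow_mul, hae, one_pow]
    rcases hl with hl | hl
    · rw [← hl, pow_add, h2, mul_one, h1]
    · rwa [hl, pow_add, h2, one_mul] at h1
  have hL : IsCotangentForm G (coeffForm v1 v2 0 e) := by
    refine isCotangentForm_coeffForm hγ (hζ _ hv1) (hη _ hv2) (by omega) ?_
    intro i1 j1 i2 j2 hi hj h1 h2
    have m1 := hmod _ _ h1
    obtain rfl : i1 = 0 := by omega
    obtain rfl : i2 = 0 := by omega
    rw [zero_mul, Nat.modEq_zero_iff_dvd] at m1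
    rcases Nat.eq_zero_or_pos j1 with h0 | h0
    · exact Or.inl ⟨rfl, h0⟩
    · have := Nat.le_of_dvd h0 m1
      exact Or.inr ⟨rfl, by omega⟩
  have hM : IsCotangentForm G (coeffForm v1 v2 (r + 1) s) := by
    refine isCotangentForm_coeffForm hγ (hζ _ hv1) (hη _ hv2) (by omega) ?_
    have aux : ∀ i j, i ≤ r → j ≤ s → ζ ^ i * η ^ j = 1 → i = 0 ∧ j = 0 := by
      intro i j hi hj h
      have hib : i * b ≤ r * b := Nat.mul_le_mul_right b hi
      have hjib := Nat.ModEq.eq_of_lt_of_lt (hmod _ _ h) (by omega) (by omega)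
      rcases Nat.eq_zero_or_pos i with h0 | h0
      · exact ⟨h0, by rw [hjib, h0, zero_mul]⟩
      · have : b ≤ i * b := Nat.le_mul_of_pos_left b h0
        omega
    intro i1 j1 i2 j2 hi hj h1 h2
    by_cases hi1 : i1 ≤ r
    · exact Or.inl (aux _ _ hi1 (by omega) h1)
    · exact Or.inr (aux _ _ (by omega) (by omega) h2)
  have hφ2 := hφ _ hv2
  have hψ1 := hψ _ hv1
  have hw1 := hψ _ (hstab1 w hw v1 hv1)
  have hw2 := hφ _ (hstab2 w hw v2 hv2)
  have key := ht.pairing_eq hs hL hM (hinv 0 e 1 (by omega)) (hinv (r + 1) s 1 (by omega))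
    (hinv 1 b 0 (by omega)) (hinv r (r * b) 0 (by omega))
    (constantCoeff_linPoly_pow_mul φ ψ (by omega)) (constantCoeff_linPoly_pow_mul φ ψ (by omega))
    (constantCoeff_linPoly_pow_mul φ ψ (by omega)) (constantCoeff_linPoly_pow_mul φ ψ (by omega))
    (by
      rw [pow_zero, one_mul, mul_left_comm, ← pow_add, ← hs']
      ring)
    ⟨w⁻¹, inv_mem hw⟩
    (by rw [coeffForm_apply, coeff_planeRestrict_linPoly_pow hφ2 hψ1, if_neg (by omega)])
    (by rw [coeffForm_apply, coeff_planeRestrict_linPoly_pow hφ2 hψ1, if_neg (by omega)])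
    (by
      rw [coeffForm_apply, planeRestrict_matAct, inv_inv, coeff_planeRestrict_linPoly_pow hw2 hw1,
        if_neg (by omega)])
    (by
      rw [coeffForm_apply, planeRestrict_matAct, inv_inv, coeff_planeRestrict_linPoly_pow hw2 hw1,
        if_neg (by omega)])
  simp only [coeffForm_apply, planeRestrict_matAct, inv_inv,
    coeff_planeRestrict_linPoly_pow hφ2 hψ1, coeff_planeRestrict_linPoly_pow hw2 hw1] at key
  simp only [and_true, if_true, pow_zero, one_mul, Nat.succ_ne_zero,
    (Nat.succ_ne_zero r).symm, false_and, if_false, zero_mul, add_zero] at key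
  rw [hs', pow_add, pow_add]
  linear_combination key

section linear

variable {n : ℕ}

lemma gl_ext_of_isCompl {V1 V2 : Submodule k (Fin n → k)} (hc : IsCompl V1 V2)
    {g h : Matrix.GeneralLinearGroup (Fin n) k}
    (h1 : ∀ x ∈ V1, Matrix.mulVec (g : Matrix (Fin n) (Fin n) k) x =
      Matrix.mulVec (h : Matrix (Fin n) (Fin n) k) x)
    (h2 : ∀ x ∈ V2, Matrix.mulVec (g : Matrix (Fin n) (Fin n) k) x =
      Matrix.mulVec (h : Matrix (Fin n) (Fin n) k) x) : g = h := by
  have : Matrix.toLin' (g : Matrix (Fin n) (Fin n) k) = Matrix.toLin' h.1 :=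
    linearMap_ext_isCompl hc (by simpa using h1) (by simpa using h2)
  exact Units.ext (Matrix.toLin'.injective this)

lemma mem_pointStab {L : Submodule k (Fin n → k)} {g : Matrix.GeneralLinearGroup (Fin n) k} :
    g ∈ pointStab L ↔ ∀ x ∈ L, Matrix.mulVec (g : Matrix (Fin n) (Fin n) k) x = x := Iff.rfl

lemma mulVec_inv_mulVec (g : Matrix.GeneralLinearGroup (Fin n) k) (x : Fin n → k) :
    Matrix.mulVec (g : Matrix (Fin n) (Fin n) k)
      (Matrix.mulVec ((g⁻¹ : Matrix.GeneralLinearGroup (Fin n) k) :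
        Matrix (Fin n) (Fin n) k) x) = x := by
  rw [Matrix.mulVec_mulVec, ← Units.val_mul, mul_inv_cancel, Units.val_one, Matrix.one_mulVec]

lemma mul_mulVec (g h : Matrix.GeneralLinearGroup (Fin n) k) (x : Fin n → k) :
    Matrix.mulVec ((g * h : Matrix.GeneralLinearGroup (Fin n) k) : Matrix (Fin n) (Fin n) k) x =
      Matrix.mulVec (g : Matrix (Fin n) (Fin n) k)
        (Matrix.mulVec (h : Matrix (Fin n) (Fin n) k) x) := by
  rw [Units.val_mul, Matrix.mulVec_mulVec]

lemma ActsAs.mul {g h : Matrix.GeneralLinearGroup (Fin n) k} {V : Submodule k (Fin n → k)}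
    {a b : k} (hg : ActsAs g V a) (hh : ActsAs h V b) : ActsAs (g * h) V (a * b) := by
  intro x hx
  rw [mul_mulVec, hh x hx, Matrix.mulVec_smul, hg x hx, smul_smul, mul_comm]

lemma actsAs_one (V : Submodule k (Fin n → k)) :
    ActsAs (1 : Matrix.GeneralLinearGroup (Fin n) k) V 1 := by
  intro x _
  rw [Units.val_one, Matrix.one_mulVec, one_smul]

lemma ActsAs.pow {g : Matrix.GeneralLinearGroup (Fin n) k} {V : Submodule k (Fin n → k)}
    {a : k} (hg : ActsAs g V a) (i : ℕ) : ActsAs (g ^ i) V (a ^ i) := by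
  induction i with
  | zero => simpa using actsAs_one V
  | succ i ih => rw [pow_succ, pow_succ]; exact ih.mul hg

lemma ActsAs.unique {g : Matrix.GeneralLinearGroup (Fin n) k} {V : Submodule k (Fin n → k)}
    {a b : k} (ha : ActsAs g V a) (hb : ActsAs g V b) (hV : V ≠ ⊥) : a = b := by
  obtain ⟨x, hx, hx0⟩ := Submodule.exists_mem_ne_zero_of_ne_bot hV
  exact smul_left_injective k hx0 ((ha x hx).symm.trans (hb x hx))

lemma actsAs_one_iff {g : Matrix.GeneralLinearGroup (Fin n) k} {V : Submodule k (Fin n → k)} :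
    ActsAs g V 1 ↔ g ∈ pointStab V := by
  simp only [ActsAs, one_smul, mem_pointStab]

lemma ActsAs.eq {V1 V2 : Submodule k (Fin n → k)} (hc : IsCompl V1 V2)
    {g h : Matrix.GeneralLinearGroup (Fin n) k} {a b : k} (hg1 : ActsAs g V1 a)
    (hg2 : ActsAs g V2 b) (hh1 : ActsAs h V1 a) (hh2 : ActsAs h V2 b) : g = h :=
  gl_ext_of_isCompl hc (fun x hx => (hg1 x hx).trans (hh1 x hx).symm)
    fun x hx => (hg2 x hx).trans (hh2 x hx).symm

lemma IsReflection.exists_smul_eq {M : Matrix (Fin n) (Fin n) k} (hM : IsReflection M)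
    {x : Fin n → k} (hx : Matrix.mulVec M x - x ≠ 0) (y : Fin n → k) :
    ∃ a : k, Matrix.mulVec M y - y = a • (Matrix.mulVec M x - x) := by
  set f : (Fin n → k) →ₗ[k] (Fin n → k) := Matrix.toLin' M - LinearMap.id with hf
  have hfx : ∀ z, f z = Matrix.mulVec M z - z := fun z => by simp [hf]
  have h1 := f.finrank_range_add_finrank_ker
  rw [Module.finrank_fin_fun] at h1
  have h2 : Module.finrank k (LinearMap.range f) = 1 := by
    have h3 : Module.finrank k (LinearMap.ker f) + 1 = n := hM.2
    omega
  have hne : (⟨f x, x, rfl⟩ : LinearMap.range f) ≠ 0 := fun h => hx (by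
    rw [← hfx]; exact congrArg Subtype.val h)
  obtain ⟨a, ha⟩ := (finrank_eq_one_iff_of_nonzero' _ hne).1 h2 ⟨f y, y, rfl⟩
  refine ⟨a, ?_⟩
  rw [← hfx, ← hfx]
  exact (congrArg Subtype.val ha).symm

lemma IsReflection.mem_pointStab_or {V1 V2 : Submodule k (Fin n → k)} (hc : IsCompl V1 V2)
    {r : Matrix.GeneralLinearGroup (Fin n) k}
    (hr : IsReflection (r : Matrix (Fin n) (Fin n) k))
    (h1 : ∀ x ∈ V1, Matrix.mulVec (r : Matrix (Fin n) (Fin n) k) x ∈ V1)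
    (h2 : ∀ x ∈ V2, Matrix.mulVec (r : Matrix (Fin n) (Fin n) k) x ∈ V2) :
    r ∈ pointStab V1 ∨ r ∈ pointStab V2 := by
  by_contra! hcon
  simp only [mem_pointStab, not_forall] at hcon
  obtain ⟨⟨x, hx, hrx⟩, ⟨y, hy, hry⟩⟩ := hcon
  obtain ⟨a, ha⟩ := hr.exists_smul_eq (sub_ne_zero.2 hrx) y
  refine hry (sub_eq_zero.1 ?_)
  refine (Submodule.disjoint_def.1 hc.disjoint) _ ?_ (sub_mem (h2 y hy) hy)
  rw [ha]
  exact V1.smul_mem a (sub_mem (h1 x hx) hx)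

/-- A group normalized by `Wt` which meets a pointwise stabilizer trivially commutes with it. -/
lemma commute_of_mem_pointStab {Wt G : Subgroup (Matrix.GeneralLinearGroup (Fin n) k)}
    (hle : G ≤ Wt) (hnormal : ∀ w ∈ Wt, ∀ g ∈ G, w * g * w⁻¹ ∈ G)
    {V : Submodule k (Fin n → k)}
    (hstab : ∀ w ∈ Wt, ∀ x ∈ V, Matrix.mulVec (w : Matrix (Fin n) (Fin n) k) x ∈ V)
    (hG : G ⊓ pointStab V = ⊥) {g w : Matrix.GeneralLinearGroup (Fin n) k} (hg : g ∈ G)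
    (hw : w ∈ Wt) (hwV : w ∈ pointStab V) : Commute g w := by
  have h1 : g * w * g⁻¹ * w⁻¹ ∈ G := by
    have := mul_mem hg (hnormal w hw _ (inv_mem hg))
    simpa only [mul_assoc] using this
  have h2 : g * w * g⁻¹ * w⁻¹ ∈ pointStab V := by
    refine mul_mem (fun x hx => ?_) (inv_mem hwV)
    rw [mul_mulVec, mul_mulVec, hwV _ (hstab _ (hle (inv_mem hg)) x hx), mulVec_inv_mulVec]
  have h3 : g * w * g⁻¹ * w⁻¹ ∈ G ⊓ pointStab V := ⟨h1, h2⟩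
  rw [hG, Subgroup.mem_bot] at h3
  exact (mul_inv_eq_iff_eq_mul.1 (mul_inv_eq_one.1 h3))

lemma commute_of_isReflectionGroup {Wt G : Subgroup (Matrix.GeneralLinearGroup (Fin n) k)}
    (hW : IsReflectionGroup Wt)
    (hle : G ≤ Wt) (hnormal : ∀ w ∈ Wt, ∀ g ∈ G, w * g * w⁻¹ ∈ G)
    {V1 V2 : Submodule k (Fin n → k)} (hc : IsCompl V1 V2)
    (hstab1 : ∀ w ∈ Wt, ∀ x ∈ V1, Matrix.mulVec (w : Matrix (Fin n) (Fin n) k) x ∈ V1)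
    (hstab2 : ∀ w ∈ Wt, ∀ x ∈ V2, Matrix.mulVec (w : Matrix (Fin n) (Fin n) k) x ∈ V2)
    (hG1 : G ⊓ pointStab V2 = ⊥) (hG2 : G ⊓ pointStab V1 = ⊥)
    {g w : Matrix.GeneralLinearGroup (Fin n) k} (hg : g ∈ G) (hw : w ∈ Wt) : Commute g w := by
  rw [← hW] at hw
  induction hw using Subgroup.closure_induction with
  | mem r hr =>
    rcases hr.2.mem_pointStab_or hc (hstab1 r hr.1) (hstab2 r hr.1) with h | h
    · exact commute_of_mem_pointStab hle hnormal hstab1 hG2 hg hr.1 h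
    · exact commute_of_mem_pointStab hle hnormal hstab2 hG1 hg hr.1 h
  | one => exact Commute.one_right g
  | mul x y _ _ hx hy => exact hx.mul_right hy
  | inv x _ hx => exact hx.inv_right

/-- Elements commuting with a reflection group act by scalars on its irreducible summands. -/
lemma exists_actsAs {Wt : Subgroup (Matrix.GeneralLinearGroup (Fin n) k)}
    (hW : IsReflectionGroup Wt) {V : Submodule k (Fin n → k)}
    (hstab : ∀ w ∈ Wt, ∀ x ∈ V, Matrix.mulVec (w : Matrix (Fin n) (Fin n) k) x ∈ V)
    (hirr : ∀ U : Submodule k (Fin n → k), U ≤ V →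
      (∀ w ∈ Wt, ∀ x ∈ U, Matrix.mulVec (w : Matrix (Fin n) (Fin n) k) x ∈ U) →
        U = ⊥ ∨ U = V)
    (hnt : ¬ Wt ≤ pointStab V) {g : Matrix.GeneralLinearGroup (Fin n) k}
    (hcomm : ∀ w ∈ Wt, Commute g w) : ∃ a : k, ActsAs g V a := by
  have : ∃ r ∈ Wt, IsReflection (r : Matrix (Fin n) (Fin n) k) ∧ r ∉ pointStab V := by
    by_contra! hcon
    apply hnt
    rw [← hW, Subgroup.closure_le]
    exact fun r hr => hcon r hr.1 hr.2
  obtain ⟨r, hrW, hr, hrV⟩ := this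
  simp only [mem_pointStab, not_forall] at hrV
  obtain ⟨x, hx, hrx⟩ := hrV
  have hu := sub_ne_zero.2 hrx
  obtain ⟨a, ha⟩ := hr.exists_smul_eq hu (Matrix.mulVec (g : Matrix (Fin n) (Fin n) k) x)
  rw [← mul_mulVec, ← (hcomm r hrW).eq, mul_mulVec, ← Matrix.mulVec_sub] at ha
  have hmem : ∀ y, y ∈ V ⊓ LinearMap.ker (Matrix.toLin' (g : Matrix (Fin n) (Fin n) k) -
      a • LinearMap.id) ↔ y ∈ V ∧ Matrix.mulVec (g : Matrix (Fin n) (Fin n) k) y = a • y :=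
    fun y => by simp [sub_eq_zero]
  have hUstab : ∀ w ∈ Wt, ∀ y ∈ V ⊓ LinearMap.ker (Matrix.toLin'
      (g : Matrix (Fin n) (Fin n) k) - a • LinearMap.id),
      Matrix.mulVec (w : Matrix (Fin n) (Fin n) k) y ∈ V ⊓ LinearMap.ker (Matrix.toLin'
      (g : Matrix (Fin n) (Fin n) k) - a • LinearMap.id) := by
    intro w hw y hy
    rw [hmem] at hy ⊢
    refine ⟨hstab w hw y hy.1, ?_⟩
    rw [← mul_mulVec, (hcomm w hw).eq, mul_mulVec, hy.2, Matrix.mulVec_smul]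
  refine ⟨a, ?_⟩
  rcases hirr (V ⊓ LinearMap.ker (Matrix.toLin' (g : Matrix (Fin n) (Fin n) k) -
    a • LinearMap.id)) inf_le_left hUstab with h | h
  · have h0 := (hmem _).2 ⟨sub_mem (hstab r hrW x hx) hx, ha⟩
    rw [h, Submodule.mem_bot] at h0
    exact absurd h0 hu
  · intro y hy
    rw [← h] at hy
    exact ((hmem y).1 hy).2

lemma exists_monoidHom_actsAs {G : Subgroup (Matrix.GeneralLinearGroup (Fin n) k)}
    {V : Submodule k (Fin n → k)} (hV : V ≠ ⊥) (hG : G ⊓ pointStab V = ⊥)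
    (h : ∀ g ∈ G, ∃ a : k, ActsAs g V a) :
    ∃ α : ↥G →* k, Function.Injective α ∧ ∀ g : ↥G, ActsAs (g : _) V (α g) := by
  choose! α hα using h
  have hone : α 1 = 1 := (hα 1 G.one_mem).unique (actsAs_one V) hV
  have hmul : ∀ g ∈ G, ∀ h ∈ G, α (g * h) = α g * α h := fun g hg h hh =>
    (hα _ (mul_mem hg hh)).unique ((hα g hg).mul (hα h hh)) hV
  refine ⟨⟨⟨fun g => α g, hone⟩, fun g h => hmul g g.2 h h.2⟩, ?_, fun g => hα g g.2⟩
  intro g h hgh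
  have hgh' : α g = α h := hgh
  have h1 : α (g * (h : Matrix.GeneralLinearGroup (Fin n) k)⁻¹) = 1 := by
    rw [hmul _ g.2 _ (inv_mem h.2), hgh', ← hmul _ h.2 _ (inv_mem h.2), mul_inv_cancel, hone]
  have h2 := hα _ (mul_mem g.2 (inv_mem h.2))
  rw [h1, actsAs_one_iff] at h2
  have h3 : (g * (h : Matrix.GeneralLinearGroup (Fin n) k)⁻¹ :
      Matrix.GeneralLinearGroup (Fin n) k) ∈ G ⊓ pointStab V :=
    Subgroup.mem_inf.2 ⟨mul_mem g.2 (inv_mem h.2), h2⟩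
  rw [hG, Subgroup.mem_bot] at h3
  exact Subtype.ext (mul_inv_eq_one.1 h3)

lemma exists_mul_of_isReflectionGroup {Wt : Subgroup (Matrix.GeneralLinearGroup (Fin n) k)}
    (hW : IsReflectionGroup Wt) {V1 V2 : Submodule k (Fin n → k)} (hc : IsCompl V1 V2)
    (hstab1 : ∀ w ∈ Wt, ∀ x ∈ V1, Matrix.mulVec (w : Matrix (Fin n) (Fin n) k) x ∈ V1)
    (hstab2 : ∀ w ∈ Wt, ∀ x ∈ V2, Matrix.mulVec (w : Matrix (Fin n) (Fin n) k) x ∈ V2)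
    {w : Matrix.GeneralLinearGroup (Fin n) k} (hw : w ∈ Wt) :
    ∃ w1 ∈ Wt ⊓ pointStab V2, ∃ w2 ∈ Wt ⊓ pointStab V1, w1 * w2 = w := by
  have hcomm : ∀ w1 ∈ Wt ⊓ pointStab V2, ∀ w2 ∈ Wt ⊓ pointStab V1, w2 * w1 = w1 * w2 := by
    intro w1 h1 w2 h2
    apply gl_ext_of_isCompl hc
    · intro x hx
      rw [mul_mulVec, mul_mulVec, h2.2 x hx, h2.2 _ (hstab1 w1 h1.1 x hx)]
    · intro x hx
      rw [mul_mulVec, mul_mulVec, h1.2 x hx, h1.2 _ (hstab2 w2 h2.1 x hx)]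
  rw [← hW] at hw
  induction hw using Subgroup.closure_induction with
  | mem r hr =>
    rcases hr.2.mem_pointStab_or hc (hstab1 r hr.1) (hstab2 r hr.1) with h | h
    · exact ⟨1, one_mem _, r, ⟨hr.1, h⟩, one_mul r⟩
    · exact ⟨r, ⟨hr.1, h⟩, 1, one_mem _, mul_one r⟩
  | one => exact ⟨1, one_mem _, 1, one_mem _, mul_one 1⟩
  | mul x y _ _ hx hy =>
    obtain ⟨a1, ha1, a2, ha2, rfl⟩ := hx
    obtain ⟨b1, hb1, b2, hb2, rfl⟩ := hy
    refine ⟨a1 * b1, mul_mem ha1 hb1, a2 * b2, mul_mem ha2 hb2, ?_⟩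
    rw [mul_assoc, ← mul_assoc b1, ← hcomm b1 hb1 a2 ha2]
    simp only [mul_assoc]
  | inv x _ hx =>
    obtain ⟨a1, ha1, a2, ha2, rfl⟩ := hx
    refine ⟨a1⁻¹, inv_mem ha1, a2⁻¹, inv_mem ha2, ?_⟩
    rw [mul_inv_rev, hcomm _ (inv_mem ha1) _ (inv_mem ha2)]

lemma exists_form_of_notMem {V : Submodule k (Fin n → k)} {v : Fin n → k} (hv : v ∉ V) :
    ∃ ψ : (Fin n → k) →ₗ[k] k, (∀ x ∈ V, ψ x = 0) ∧ ψ v ≠ 0 := by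
  obtain ⟨ψ, h1, h2⟩ := Submodule.exists_le_ker_of_notMem hv
  exact ⟨ψ, fun x hx => h2 hx, h1⟩

/-- If every linear form vanishing on a complement of `V` and at `u ∈ V` vanishes at `v ∈ V`,
then `u` and `v` are proportional. -/
lemma exists_smul_eq_of_forall_form {V1 V2 : Submodule k (Fin n → k)} (hc : IsCompl V1 V2)
    {u v : Fin n → k} (hu : u ∈ V1) (hv : v ∈ V1)
    (h : ∀ φ : (Fin n → k) →ₗ[k] k, (∀ x ∈ V2, φ x = 0) → φ u = 0 → φ v = 0) :
    ∃ a : k, v = a • u := by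
  by_contra! hcon
  have hnot : v ∉ Submodule.span k {u} ⊔ V2 := by
    intro hmem
    obtain ⟨y, hy, z, hz, rfl⟩ := Submodule.mem_sup.1 hmem
    obtain ⟨a, rfl⟩ := Submodule.mem_span_singleton.1 hy
    have hz1 : z ∈ V1 := (V1.add_mem_iff_right (V1.smul_mem a hu)).1 hv
    have hz0 : z = 0 := Submodule.disjoint_def.1 hc.disjoint z hz1 hz
    exact hcon a (by rw [hz0, add_zero])
  obtain ⟨φ, hφ, hφv⟩ := exists_form_of_notMem hnot
  exact hφv (h φ (fun x hx => hφ x (Submodule.mem_sup_right hx))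
    (hφ u (Submodule.mem_sup_left (Submodule.mem_span_singleton_self u))))

lemma eq_span_singleton_of_irreducible {Wt : Subgroup (Matrix.GeneralLinearGroup (Fin n) k)}
    {V : Submodule k (Fin n → k)}
    (hirr : ∀ U : Submodule k (Fin n → k), U ≤ V →
      (∀ w ∈ Wt, ∀ x ∈ U, Matrix.mulVec (w : Matrix (Fin n) (Fin n) k) x ∈ U) →
        U = ⊥ ∨ U = V) {v : Fin n → k} (hv : v ∈ V) (hv0 : v ≠ 0)
    (h : ∀ w ∈ Wt, ∃ a : k, Matrix.mulVec (w : Matrix (Fin n) (Fin n) k) v = a • v) :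
    V = Submodule.span k {v} := by
  have hstab : ∀ w ∈ Wt, ∀ x ∈ Submodule.span k {v},
      Matrix.mulVec (w : Matrix (Fin n) (Fin n) k) x ∈ Submodule.span k {v} := by
    intro w hw x hx
    obtain ⟨b, rfl⟩ := Submodule.mem_span_singleton.1 hx
    obtain ⟨a, ha⟩ := h w hw
    rw [Matrix.mulVec_smul, ha]
    exact Submodule.smul_mem _ _ (Submodule.smul_mem _ _ (Submodule.mem_span_singleton_self v))
  rcases hirr (Submodule.span k {v}) (by simpa using hv) hstab with h0 | h0
  · exact absurd (Submodule.span_singleton_eq_bot.1 h0) hv0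
  · exact h0.symm

lemma actsAs_span_singleton {g : Matrix.GeneralLinearGroup (Fin n) k} {v : Fin n → k} {a : k}
    (h : Matrix.mulVec (g : Matrix (Fin n) (Fin n) k) v = a • v) :
    ActsAs g (Submodule.span k {v}) a := by
  intro x hx
  obtain ⟨b, rfl⟩ := Submodule.mem_span_singleton.1 hx
  rw [Matrix.mulVec_smul, h, smul_comm]

/-- A group acting faithfully on the line `V1` through `e`-th roots of unity, trivially on
the hyperplane `V2`, and containing a primitive `e`-th root of unity, is a cyclic reflection
group of order `e`. -/
lemma isCyclic_card_isReflectionGroup {H : Subgroup (Matrix.GeneralLinearGroup (Fin n) k)}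
    {V1 V2 : Submodule k (Fin n → k)} (hc : IsCompl V1 V2) (hV1 : V1 ≠ ⊥)
    (hdim : Module.finrank k V2 + 1 = n) (hH : H ≤ pointStab V2) {e : ℕ} (he : 0 < e) {ζ : k}
    (hζ : IsPrimitiveRoot ζ e) {w1 : Matrix.GeneralLinearGroup (Fin n) k} (hw1 : w1 ∈ H)
    (hw1ζ : ActsAs w1 V1 ζ) (hs : ∀ w ∈ H, ∃ s : k, ActsAs w V1 s ∧ s ^ e = 1) :
    IsCyclic ↥H ∧ Nat.card ↥H = e ∧ IsReflectionGroup H := by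
  have : NeZero e := ⟨he.ne'⟩
  have hpow : ∀ w ∈ H, ∃ i : ℕ, w1 ^ i = w := by
    intro w hw
    obtain ⟨s, hs1, hse⟩ := hs w hw
    obtain ⟨i, -, rfl⟩ := hζ.eq_pow_of_pow_eq_one hse
    exact ⟨i, ActsAs.eq hc (hw1ζ.pow i) (actsAs_one_iff.2 (hH (pow_mem hw1 i))) hs1
      (actsAs_one_iff.2 (hH hw))⟩
  have hone : ∀ i : ℕ, w1 ^ i = 1 ↔ ζ ^ i = 1 := by
    refine fun i => ⟨fun h => ?_, fun h => ?_⟩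
    · have := hw1ζ.pow i
      rw [h] at this
      exact this.unique (actsAs_one V1) hV1
    · have := hw1ζ.pow i
      rw [h] at this
      exact ActsAs.eq hc this (actsAs_one_iff.2 (hH (pow_mem hw1 i))) (actsAs_one V1)
        (actsAs_one V2)
  have hgen : ∀ x : ↥H, x ∈ Subgroup.zpowers (⟨w1, hw1⟩ : ↥H) := by
    rintro ⟨x, hx⟩
    obtain ⟨i, rfl⟩ := hpow x hx
    exact ⟨i, Subtype.ext (by simp)⟩
  refine ⟨⟨⟨_, hgen⟩⟩, ?_, ?_⟩
  · rw [← orderOf_eq_card_of_forall_mem_zpowers hgen, Subgroup.orderOf_mk]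
    refine Nat.dvd_antisymm ?_ ?_
    · rw [orderOf_dvd_iff_pow_eq_one, hone, hζ.pow_eq_one]
    · rw [← hζ.pow_eq_one_iff_dvd, ← hone, pow_orderOf_eq_one]
  · refine le_antisymm ((Subgroup.closure_le _).2 fun g hg => hg.1) fun w hw => ?_
    by_cases hw0 : w = 1
    · rw [hw0]
      exact one_mem _
    refine Subgroup.subset_closure ⟨hw, ?_, ?_⟩
    · rw [isOfFinOrder_iff_pow_eq_one]
      refine ⟨e, he, ?_⟩
      obtain ⟨i, rfl⟩ := hpow w hw
      rw [← Units.val_pow_eq_pow_val, ← pow_mul, (hone _).2 (by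
        rw [mul_comm, pow_mul, hζ.pow_eq_one, one_pow]), Units.val_one]
    · obtain ⟨s, hs1, -⟩ := hs w hw
      have hs0 : s - 1 ≠ 0 := fun h => hw0 (by
        rw [sub_eq_zero.1 h] at hs1
        exact ActsAs.eq hc hs1 (actsAs_one_iff.2 (hH hw)) (actsAs_one V1) (actsAs_one V2))
      have hker : LinearMap.ker (Matrix.toLin' (w : Matrix (Fin n) (Fin n) k) -
          LinearMap.id) = V2 := ?_
      · exact hker ▸ hdim
      ext x
      rw [LinearMap.mem_ker, LinearMap.sub_apply, Matrix.toLin'_apply, LinearMap.id_apply]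
      refine ⟨fun h => ?_, fun h => by rw [hH hw x h, sub_self]⟩
      have hx : x ∈ V1 ⊔ V2 := hc.sup_eq_top ▸ Submodule.mem_top
      obtain ⟨y, hy, z, hz, rfl⟩ := Submodule.mem_sup.1 hx
      rw [Matrix.mulVec_add, hs1 y hy, hH hw z hz, add_sub_add_right_eq_sub] at h
      have hy0 : (s - 1) • y = 0 := by rw [sub_smul, one_smul, h]
      rw [(smul_eq_zero.1 hy0).resolve_left hs0, zero_add]
      exact hz

lemma det_eq_mul_of_actsAs {V1 V2 : Submodule k (Fin 2 → k)} (hc : IsCompl V1 V2)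
    (hV1 : V1 ≠ ⊥) (hV2 : V2 ≠ ⊥) {g : Matrix.GeneralLinearGroup (Fin 2) k} {s t : k}
    (hs : ActsAs g V1 s) (ht : ActsAs g V2 t) :
    (g : Matrix (Fin 2) (Fin 2) k).det = s * t := by
  obtain ⟨v1, hv1, h1⟩ := Submodule.exists_mem_ne_zero_of_ne_bot hV1
  obtain ⟨v2, hv2, h2⟩ := Submodule.exists_mem_ne_zero_of_ne_bot hV2
  set P : Matrix (Fin 2) (Fin 2) k := Matrix.of ![v1, v2] with hP
  have hli : LinearIndependent k P.row := by
    change LinearIndependent k ![v1, v2]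
    rw [LinearIndependent.pair_iff]
    intro a b hab
    have ha : a • v1 = 0 := by
      refine Submodule.disjoint_def.1 hc.disjoint _ (V1.smul_mem a hv1) ?_
      rw [eq_neg_of_add_eq_zero_left hab]
      exact V2.neg_mem (V2.smul_mem b hv2)
    have hb : b • v2 = 0 := by rwa [ha, zero_add] at hab
    exact ⟨(smul_eq_zero.1 ha).resolve_right h1, (smul_eq_zero.1 hb).resolve_right h2⟩
  have hdet : P.det ≠ 0 := by
    have := Matrix.linearIndependent_rows_iff_isUnit.1 hli
    exact ((Matrix.isUnit_iff_isUnit_det P).1 this).ne_zero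
  have hmul : P * (g : Matrix (Fin 2) (Fin 2) k).transpose = Matrix.diagonal ![s, t] * P := by
    ext i j
    have e1 := congrFun (hs v1 hv1) j
    have e2 := congrFun (ht v2 hv2) j
    simp only [Matrix.mulVec, dotProduct, Fin.sum_univ_two, Pi.smul_apply, smul_eq_mul]
      at e1 e2
    rw [Matrix.diagonal_mul, Matrix.mul_apply]
    fin_cases i
    · simpa [hP, Fin.sum_univ_two, mul_comm] using e1
    · simpa [hP, Fin.sum_univ_two, mul_comm] using e2
  have := congrArg Matrix.det hmul
  rw [Matrix.det_mul, Matrix.det_mul, Matrix.det_transpose, Matrix.det_diagonal,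
    Fin.prod_univ_two, mul_comm] at this
  exact mul_right_cancel₀ hdet this

end linear

/-- suppose `G` is good, `Vt = V1 ⊕ V2` with `V1, V2` irreducible
`Wt`-stable subspaces, `G ∩ Wt_1 = 1`, `G ∩ Wt_2 = 1` and `G ≠ 1`. Then `dim Vt = 2`,
there is an integer `d0` such that `Wt_1` and `Wt_2` are cyclic reflection groups of
order `d0`, and `G = Wt ∩ SL(Vt)`. -/
theorem statement12 [CharZero k] {n m : ℕ}
    (Wt G : Subgroup (Matrix.GeneralLinearGroup (Fin n) k))
    (p : Fin m → MvPolynomial (Fin n) k) (d : Fin m → ℕ)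
    (c : ↥Wt → Fin m → Fin m → k)
    (hsetup : QuotSetup Wt G p d c)
    (hgood : IsGoodQuot Wt p c)
    (V1 V2 : Submodule k (Fin n → k)) (hcompl : IsCompl V1 V2)
    (hstab1 : ∀ w ∈ Wt, ∀ x ∈ V1,
      Matrix.mulVec ((w : Matrix.GeneralLinearGroup (Fin n) k) :
        Matrix (Fin n) (Fin n) k) x ∈ V1)
    (hstab2 : ∀ w ∈ Wt, ∀ x ∈ V2,
      Matrix.mulVec ((w : Matrix.GeneralLinearGroup (Fin n) k) :
        Matrix (Fin n) (Fin n) k) x ∈ V2)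
    (hirr1 : V1 ≠ ⊥ ∧ ∀ U : Submodule k (Fin n → k), U ≤ V1 →
      (∀ w ∈ Wt, ∀ x ∈ U, Matrix.mulVec ((w : Matrix.GeneralLinearGroup (Fin n) k) :
        Matrix (Fin n) (Fin n) k) x ∈ U) → U = ⊥ ∨ U = V1)
    (hirr2 : V2 ≠ ⊥ ∧ ∀ U : Submodule k (Fin n → k), U ≤ V2 →
      (∀ w ∈ Wt, ∀ x ∈ U, Matrix.mulVec ((w : Matrix.GeneralLinearGroup (Fin n) k) :
        Matrix (Fin n) (Fin n) k) x ∈ U) → U = ⊥ ∨ U = V2)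
    (hG1 : G ⊓ pointStab V2 = ⊥) (hG2 : G ⊓ pointStab V1 = ⊥) (hG : G ≠ ⊥) :
    n = 2 ∧
    (∃ d0 : ℕ,
      IsCyclic ↥(Wt ⊓ pointStab V2) ∧ Nat.card ↥(Wt ⊓ pointStab V2) = d0 ∧
      IsReflectionGroup (Wt ⊓ pointStab V2) ∧
      IsCyclic ↥(Wt ⊓ pointStab V1) ∧ Nat.card ↥(Wt ⊓ pointStab V1) = d0 ∧
      IsReflectionGroup (Wt ⊓ pointStab V1)) ∧
    G = Wt ⊓ MonoidHom.ker
      (Matrix.GeneralLinearGroup.det :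
        Matrix.GeneralLinearGroup (Fin n) k →* kˣ) := by
  have hcomm : ∀ g ∈ G, ∀ w ∈ Wt, Commute g w := fun g hg w hw =>
    commute_of_isReflectionGroup hsetup.reflGroup hsetup.le hsetup.normal hcompl hstab1 hstab2
      hG1 hG2 hg hw
  have hnt : ∀ V : Submodule k (Fin n → k), G ⊓ pointStab V = ⊥ → ¬ Wt ≤ pointStab V :=
    fun V hV h => hG (by rw [← hV, left_eq_inf]; exact hsetup.le.trans h)
  obtain ⟨α, hαinj, hα⟩ := exists_monoidHom_actsAs hirr1.1 hG2 fun g hg =>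
    exists_actsAs hsetup.reflGroup hstab1 hirr1.2 (hnt V1 hG2) (hcomm g hg)
  obtain ⟨β, hβinj, hβ⟩ := exists_monoidHom_actsAs hirr2.1 hG1 fun g hg =>
    exists_actsAs hsetup.reflGroup hstab2 hirr2.2 (hnt V2 hG1) (hcomm g hg)
  have hfin : Finite ↥G := (hsetup.finite.subset hsetup.le).to_subtype
  have hcyc : IsCyclic ↥G := isCyclic_of_injective_ringHom α hαinj
  obtain ⟨γ, hγ⟩ := IsCyclic.exists_monoid_generator (α := ↥G)
  have hγ1 : γ ≠ 1 := by
    rintro rfl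
    refine hG ((Subgroup.eq_bot_iff_forall _).2 fun g hg => ?_)
    obtain ⟨i, hi⟩ := hγ ⟨g, hg⟩
    simpa using (congrArg Subtype.val hi).symm
  set e := orderOf γ with he
  have he0 : 0 < e := orderOf_pos γ
  have he1 : e ≠ 1 := fun h => hγ1 (orderOf_eq_one_iff.1 h)
  have : NeZero e := ⟨he0.ne'⟩
  have hζ : IsPrimitiveRoot (α γ) e := by
    rw [he, ← orderOf_injective α hαinj]
    exact IsPrimitiveRoot.orderOf _
  have hη : IsPrimitiveRoot (β γ) e := by
    rw [he, ← orderOf_injective β hβinj]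
    exact IsPrimitiveRoot.orderOf _
  obtain ⟨b, hbe, hb⟩ := hη.eq_pow_of_pow_eq_one (ξ := (α γ)⁻¹)
    (by rw [inv_pow, hζ.pow_eq_one, inv_one])
  have hζ0 : α γ ≠ 0 := hζ.ne_zero he0.ne'
  have hζη : α γ * β γ ^ b = 1 := by rw [hb, mul_inv_cancel₀ hζ0]
  have hb0 : 0 < b := by
    rw [Nat.pos_iff_ne_zero]
    rintro rfl
    rw [pow_zero, mul_one] at hζη
    exact hγ1 (hαinj (by rw [hζη, map_one]))
  have hmod : ∀ i j, α γ ^ i * β γ ^ j = 1 → j ≡ i * b [MOD e] := by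
    intro i j hij
    have h1 : α γ ^ i * β γ ^ (i * b) = 1 := by
      rw [mul_comm i b, pow_mul, ← mul_pow, hζη, one_pow]
    have h2 : β γ ^ j = β γ ^ (i * b) :=
      mul_left_cancel₀ (pow_ne_zero i hζ0) (hij.trans h1.symm)
    rw [← map_pow, ← map_pow] at h2
    exact pow_eq_pow_iff_modEq.1 (hβinj h2)
  have hGchar : ∀ g ∈ G, ∃ a a' : k, ActsAs g V1 a ∧ ActsAs g V2 a' ∧ a * a' ^ b = 1 ∧
      a' ^ e = 1 := by
    intro g hg
    obtain ⟨i, hi⟩ := hγ ⟨g, hg⟩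
    refine ⟨α ⟨g, hg⟩, β ⟨g, hg⟩, hα ⟨g, hg⟩, hβ ⟨g, hg⟩, ?_, ?_⟩
    · rw [← hi, map_pow, map_pow, pow_right_comm, ← mul_pow, hζη, one_pow]
    · rw [← hi, map_pow, pow_right_comm, hη.pow_eq_one, one_pow]
  obtain ⟨r, hr, hrb, her⟩ : ∃ r, 0 < r ∧ r * b < e ∧ e ≤ (r + 1) * b := by
    refine ⟨(e - 1) / b, Nat.div_pos (by omega) hb0, ?_, ?_⟩
    · have := Nat.div_mul_le_self (e - 1) b
      omega
    · have := Nat.lt_div_mul_add hb0 (a := e - 1)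
      rw [add_mul, one_mul]
      omega
  have hstar := fun φ ψ hφ hψ v1 v2 hv1 hv2 w hw =>
    hgood.2.apply_pow_mul_apply_pow_eq hsetup hcompl hstab1 hstab2 γ.2 (hα γ) (hβ γ) hbe hr hrb
      her hmod hGchar (φ := φ) (ψ := ψ) hφ hψ (v1 := v1) (v2 := v2) hv1 hv2 (w := w) hw
  obtain ⟨v1, hv1, hv10⟩ := Submodule.exists_mem_ne_zero_of_ne_bot hirr1.1
  obtain ⟨v2, hv2, hv20⟩ := Submodule.exists_mem_ne_zero_of_ne_bot hirr2.1
  obtain ⟨φ, hφ, hφ1⟩ := exists_form_of_notMem fun h =>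
    hv10 (Submodule.disjoint_def.1 hcompl.disjoint v1 hv1 h)
  obtain ⟨ψ, hψ, hψ2⟩ := exists_form_of_notMem fun h =>
    hv20 (Submodule.disjoint_def.1 hcompl.disjoint v2 h hv2)
  have hrb0 : (r + 1) * b ≠ 0 := by positivity
  have hline1 : V1 = Submodule.span k {v1} := by
    refine eq_span_singleton_of_irreducible hirr1.2 hv1 hv10 fun w hw => ?_
    obtain ⟨a, ha⟩ := exists_smul_eq_of_forall_form hcompl (hstab1 w hw v1 hv1) hv1
      fun χ hχ hχw => by
        have h := hstar χ ψ hχ hψ v1 v2 hv1 hv2 w hw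
        rw [hχw, zero_pow (Nat.succ_ne_zero r), zero_mul, eq_comm, mul_eq_zero] at h
        exact eq_zero_of_pow_eq_zero (h.resolve_right (pow_ne_zero _ hψ2))
    have ha0 : a ≠ 0 := by
      rintro rfl
      exact hv10 (by rw [ha, zero_smul])
    exact ⟨a⁻¹, by rw [eq_inv_smul_iff₀ ha0, ← ha]⟩
  have hline2 : V2 = Submodule.span k {v2} := by
    refine eq_span_singleton_of_irreducible hirr2.2 hv2 hv20 fun w hw => ?_
    obtain ⟨a, ha⟩ := exists_smul_eq_of_forall_form hcompl.symm (hstab2 w hw v2 hv2) hv2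
      fun χ hχ hχw => by
        have h := hstar φ χ hφ hχ v1 v2 hv1 hv2 w hw
        rw [hχw, zero_pow hrb0, mul_zero, eq_comm, mul_eq_zero] at h
        exact eq_zero_of_pow_eq_zero (h.resolve_left (pow_ne_zero _ hφ1))
    have ha0 : a ≠ 0 := by
      rintro rfl
      exact hv20 (by rw [ha, zero_smul])
    exact ⟨a⁻¹, by rw [eq_inv_smul_iff₀ ha0, ← ha]⟩
  have hchar : ∀ w ∈ Wt, ∃ s t : k, ActsAs w V1 s ∧ ActsAs w V2 t ∧
      s ^ (r + 1) * t ^ ((r + 1) * b) = 1 := by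
    intro w hw
    have m1 := hstab1 w hw v1 hv1
    have m2 := hstab2 w hw v2 hv2
    rw [hline1] at m1
    rw [hline2] at m2
    obtain ⟨s, hs⟩ := Submodule.mem_span_singleton.1 m1
    obtain ⟨t, ht⟩ := Submodule.mem_span_singleton.1 m2
    refine ⟨s, t, hline1 ▸ actsAs_span_singleton hs.symm,
      hline2 ▸ actsAs_span_singleton ht.symm, ?_⟩
    have h := hstar φ ψ hφ hψ v1 v2 hv1 hv2 w hw
    rw [← hs, ← ht, map_smul, map_smul, smul_eq_mul, smul_eq_mul, mul_pow, mul_pow] at h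
    have h0 : φ v1 ^ (r + 1) * ψ v2 ^ ((r + 1) * b) ≠ 0 :=
      mul_ne_zero (pow_ne_zero _ hφ1) (pow_ne_zero _ hψ2)
    exact mul_right_cancel₀ h0 (by linear_combination h)
  obtain ⟨w1, hw1, w2, hw2, hw12⟩ := exists_mul_of_isReflectionGroup hsetup.reflGroup hcompl
    hstab1 hstab2 (hsetup.le γ.2)
  have hw1ζ : ActsAs w1 V1 (α γ) := fun x hx => by
    rw [← hα γ x hx, ← hw12, mul_mulVec, hw2.2 x hx]
  have hw2η : ActsAs w2 V2 (β γ) := fun x hx => by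
    rw [← hβ γ x hx, ← hw12, mul_mulVec, hw1.2 _ (hstab2 w2 hw2.1 x hx)]
  obtain ⟨rfl, hre⟩ : b = 1 ∧ r + 1 = e := by
    obtain ⟨s, t, hs, ht, hst⟩ := hchar w1 hw1.1
    rw [hs.unique hw1ζ hirr1.1, ht.unique (actsAs_one_iff.2 hw1.2) hirr2.1, one_pow,
      mul_one] at hst
    have hle := Nat.le_of_dvd (Nat.succ_pos r) (hζ.dvd_of_pow_eq_one _ hst)
    have hb1 : b = 1 := by
      by_contra hb1
      have : r * 2 ≤ r * b := Nat.mul_le_mul_left r (by omega)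
      omega
    rw [hb1] at hrb
    exact ⟨hb1, by omega⟩
  rw [hre, mul_one] at hchar
  rw [pow_one] at hζη
  have hs1 : ∀ w ∈ Wt ⊓ pointStab V2, ∃ s : k, ActsAs w V1 s ∧ s ^ e = 1 := by
    intro w hw
    obtain ⟨s, t, hs, ht, hst⟩ := hchar w hw.1
    rw [ht.unique (actsAs_one_iff.2 hw.2) hirr2.1, one_pow, mul_one] at hst
    exact ⟨s, hs, hst⟩
  have hs2 : ∀ w ∈ Wt ⊓ pointStab V1, ∃ s : k, ActsAs w V2 s ∧ s ^ e = 1 := by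
    intro w hw
    obtain ⟨s, t, hs, ht, hst⟩ := hchar w hw.1
    rw [hs.unique (actsAs_one_iff.2 hw.2) hirr1.1, one_pow, one_mul] at hst
    exact ⟨t, ht, hst⟩
  have hdim := Submodule.finrank_add_eq_of_isCompl hcompl
  have hd1 : Module.finrank k V1 = 1 := by rw [hline1, finrank_span_singleton hv10]
  have hd2 : Module.finrank k V2 = 1 := by rw [hline2, finrank_span_singleton hv20]
  rw [hd1, hd2, Module.finrank_fin_fun] at hdim
  obtain rfl : n = 2 := hdim.symm
  have hcyc1 := isCyclic_card_isReflectionGroup hcompl hirr1.1 (by rw [hd2]) inf_le_right he0 hζ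
    hw1 hw1ζ hs1
  have hcyc2 := isCyclic_card_isReflectionGroup hcompl.symm hirr2.1 (by rw [hd1]) inf_le_right
    he0 hη hw2 hw2η hs2
  refine ⟨rfl, ⟨e, hcyc1.1, hcyc1.2.1, hcyc1.2.2, hcyc2.1, hcyc2.2.1, hcyc2.2.2⟩, ?_⟩
  apply le_antisymm
  · intro g hg
    obtain ⟨a, a', ha, ha', haa, -⟩ := hGchar g hg
    rw [pow_one] at haa
    refine ⟨hsetup.le hg, Units.ext ?_⟩
    exact (det_eq_mul_of_actsAs hcompl hirr1.1 hirr2.1 ha ha').trans haa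
  · rintro w ⟨hw, hdet⟩
    obtain ⟨s, t, hs, ht, -⟩ := hchar w hw
    have hst : s * t = 1 := by
      rw [← det_eq_mul_of_actsAs hcompl hirr1.1 hirr2.1 hs ht]
      exact congrArg Units.val hdet
    obtain ⟨u1, hu1, u2, hu2, rfl⟩ := exists_mul_of_isReflectionGroup hsetup.reflGroup hcompl
      hstab1 hstab2 hw
    obtain ⟨s', hs', hse⟩ := hs1 u1 hu1
    have hss : s = s' := by
      have h := hs'.mul (actsAs_one_iff.2 hu2.2)
      rw [mul_one] at h
      exact hs.unique h hirr1.1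
    obtain ⟨i, -, hi⟩ := hζ.eq_pow_of_pow_eq_one hse
    have hsi : s = α γ ^ i := hss.trans hi.symm
    have hti : t = β γ ^ i := by
      refine mul_left_cancel₀ (pow_ne_zero i hζ0) ?_
      rw [← hsi, hst, hsi, ← mul_pow, hζη, one_pow]
    have heq : (γ : Matrix.GeneralLinearGroup (Fin 2) k) ^ i = u1 * u2 :=
      ActsAs.eq hcompl ((hα γ).pow i) ((hβ γ).pow i) (hsi ▸ hs) (hti ▸ ht)
    rw [← heq]
    exact pow_mem γ.2 i

end ReflQuot
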